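/- Fix an integer m ≥ 2, λ > 0, a Borel probability measure μ₀ on ℝ, and let b : ℕ → ℝ be defined by b(1) = 1 and, for n > 1, b(n) = (m−1)^{−1} ( 1 − Σ_{(i₁,…,i_{m−1}): each i_k < n, Σ i_k = n+m−2} ∏_{k=1}^{m−1} b(i_k) ). For t ≥ 0 define the signed measure ν_t = Σ_{n≥1} b(n) e^{−λt}(1−e^{−(m−1)λt})^{n−1} μ₀^{*[(m−1)(n−1)+1]}. Then the (m−1)-fold convolution of ν_t with itself satisfies ν_t^{*(m−1)} = Σ_{n≥1} e^{−(m−1)λt}(1−e^{−(m−1)λt})^{n−1} μ₀^{*(m−1)n}. -/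

import Mathlib

open MeasureTheory

/-- `n`-fold convolution power of a measure on `ℝ`: `convPow μ 0 = δ₀` and
`convPow μ (n+1) = (convPow μ n) ∗ μ`. In particular `convPow μ 1 = δ₀ ∗ μ = μ`. -/
noncomputable def convPow (μ : Measure ℝ) : ℕ → Measure ℝ
  | 0 => Measure.dirac 0
  | n + 1 => Measure.conv (convPow μ n) μ

/-- Convolution of two finite signed measures on `ℝ`, defined through the Jordan
decomposition: `(s⁺∗t⁺ + s⁻∗t⁻) − (s⁺∗t⁻ + s⁻∗t⁺)`. -/
noncomputable def sconv (s t : SignedMeasure ℝ) : SignedMeasure ℝ :=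
  (Measure.conv s.toJordanDecomposition.posPart t.toJordanDecomposition.posPart +
      Measure.conv s.toJordanDecomposition.negPart t.toJordanDecomposition.negPart).toSignedMeasure -
    (Measure.conv s.toJordanDecomposition.posPart t.toJordanDecomposition.negPart +
        Measure.conv s.toJordanDecomposition.negPart t.toJordanDecomposition.posPart).toSignedMeasure

/-- `k`-fold convolution power of a signed measure on `ℝ`, with
`sconvPow s 0 = δ₀` (as a signed measure) and `sconvPow s (k+1) = (sconvPow s k) ∗ s`. -/
noncomputable def sconvPow (s : SignedMeasure ℝ) : ℕ → SignedMeasure ℝ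
  | 0 => (Measure.dirac (0 : ℝ)).toSignedMeasure
  | k + 1 => sconv (sconvPow s k) s

open scoped ENNReal NNReal

instance isProbabilityMeasure_convPow (μ : Measure ℝ) [IsProbabilityMeasure μ] (n : ℕ) :
    IsProbabilityMeasure (convPow μ n) := by
  induction n with
  | zero => unfold convPow; infer_instance
  | succ n ih => unfold convPow; infer_instance

instance isFiniteMeasure_convPow (μ : Measure ℝ) [IsFiniteMeasure μ] (n : ℕ) :
    IsFiniteMeasure (convPow μ n) := by
  induction n with
  | zero => unfold convPow; infer_instance
  | succ n ih => unfold convPow; infer_instance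

theorem convPow_add (μ : Measure ℝ) [IsFiniteMeasure μ] (i j : ℕ) :
    convPow μ (i + j) = Measure.conv (convPow μ i) (convPow μ j) := by
  induction j with
  | zero => simp [convPow, Measure.conv_dirac_zero]
  | succ j ih =>
    rw [← add_assoc, convPow, convPow, ih, Measure.conv_assoc]

theorem sconv_toSignedMeasure (μ ν : Measure ℝ) [IsFiniteMeasure μ] [IsFiniteMeasure ν] :
    sconv μ.toSignedMeasure ν.toSignedMeasure = (Measure.conv μ ν).toSignedMeasure := by
  have key (ρ : Measure ℝ) [IsFiniteMeasure ρ] : ρ.toSignedMeasure.toJordanDecomposition =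
      ⟨ρ, 0, Measure.MutuallySingular.zero_right⟩ :=
    SignedMeasure.toJordanDecomposition_eq (by simp [JordanDecomposition.toSignedMeasure])
  simp [sconv, key]

theorem sconvPow_toSignedMeasure (μ : Measure ℝ) [IsFiniteMeasure μ] (k : ℕ) :
    sconvPow μ.toSignedMeasure k = (convPow μ k).toSignedMeasure := by
  induction k with
  | zero => rfl
  | succ k ih => rw [sconvPow, ih, sconv_toSignedMeasure]; rfl

/-- The measure `∑ₙ fₙ μ^{*(p n + k)}` attached to a power series `f = ∑ₙ fₙ Xⁿ`. -/
noncomputable def convSeries (μ : Measure ℝ) (p : ℕ) (f : PowerSeries ℝ≥0) (k : ℕ) : Measure ℝ :=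
  Measure.sum fun n => (f.coeff n : ℝ≥0∞) • convPow μ (p * n + k)

theorem convSeries_apply (μ : Measure ℝ) (p : ℕ) (f : PowerSeries ℝ≥0) (k : ℕ) {A : Set ℝ}
    (hA : MeasurableSet A) :
    convSeries μ p f k A = ∑' n, (f.coeff n : ℝ≥0∞) * convPow μ (p * n + k) A := by
  simp [convSeries, Measure.sum_apply _ hA]

theorem convSeries_real_apply (μ : Measure ℝ) [IsProbabilityMeasure μ] (p : ℕ)
    (f : PowerSeries ℝ≥0) (k : ℕ) {A : Set ℝ} (hA : MeasurableSet A) :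
    (convSeries μ p f k).real A = ∑' n, (f.coeff n : ℝ) * (convPow μ (p * n + k) A).toReal := by
  rw [measureReal_def, convSeries_apply _ _ _ _ hA, ENNReal.tsum_toReal_eq]
  · simp
  · exact fun n => ENNReal.mul_ne_top ENNReal.coe_ne_top (measure_ne_top _ _)

theorem isFiniteMeasure_convSeries (μ : Measure ℝ) [IsProbabilityMeasure μ] (p : ℕ)
    (f : PowerSeries ℝ≥0) (k : ℕ) (hf : Summable fun n => f.coeff n) :
    IsFiniteMeasure (convSeries μ p f k) := by
  constructor
  simp only [convSeries_apply _ _ _ _ MeasurableSet.univ, measure_univ, mul_one]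
  exact (ENNReal.tsum_coe_ne_top_iff_summable.2 hf).lt_top

theorem convSeries_one_zero (μ : Measure ℝ) (p : ℕ) :
    convSeries μ p 1 0 = Measure.dirac 0 := by
  ext A hA
  rw [convSeries_apply _ _ _ _ hA, tsum_eq_single 0]
  · simp [convPow]
  · intro n hn
    simp [PowerSeries.coeff_one, hn]

theorem convSeries_conv (μ : Measure ℝ) [IsProbabilityMeasure μ] (p : ℕ)
    (f g : PowerSeries ℝ≥0) (k l : ℕ) :
    Measure.conv (convSeries μ p f k) (convSeries μ p g l) = convSeries μ p (f * g) (k + l) := by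
  have h : Measure.conv (convSeries μ p f k) (convSeries μ p g l) =
      Measure.sum fun x : ℕ × ℕ =>
        ((f.coeff x.1 : ℝ≥0∞) * g.coeff x.2) • convPow μ (p * (x.1 + x.2) + (k + l)) := by
    rw [Measure.conv, convSeries, convSeries, Measure.prod_sum,
      Measure.map_sum (by fun_prop)]
    congr 1
    ext1 x
    rw [show p * (x.1 + x.2) + (k + l) = (p * x.1 + k) + (p * x.2 + l) by ring,
      convPow_add μ (p * x.1 + k), Measure.prod_smul_left, Measure.prod_smul_right,
      Measure.map_smul, Measure.map_smul, smul_smul, Measure.conv]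
  ext A hA
  rw [h, Measure.sum_apply _ hA, convSeries_apply _ _ _ _ hA,
    ← (Finset.HasAntidiagonal.sigmaAntidiagonalEquivProd (A := ℕ)).tsum_eq fun x : ℕ × ℕ =>
      (((f.coeff x.1 : ℝ≥0∞) * g.coeff x.2) • convPow μ (p * (x.1 + x.2) + (k + l))) A, ENNReal.tsum_sigma']
  congr 1
  ext1 n
  rw [tsum_fintype, PowerSeries.coeff_mul, ENNReal.ofNNReal_finsetSum, Finset.sum_mul,
    ← Finset.sum_coe_sort (Finset.HasAntidiagonal.antidiagonal n)]
  refine Finset.sum_congr rfl fun x _ => ?_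
  simp [Finset.HasAntidiagonal.sigmaAntidiagonalEquivProd,
    Finset.HasAntidiagonal.mem_antidiagonal.1 x.2]

theorem convPow_convSeries (μ : Measure ℝ) [IsProbabilityMeasure μ] (p : ℕ)
    (f : PowerSeries ℝ≥0) (k : ℕ) :
    convPow (convSeries μ p f 1) k = convSeries μ p (f ^ k) k := by
  induction k with
  | zero => rw [convPow, pow_zero, convSeries_one_zero]
  | succ k ih => rw [convPow, ih, convSeries_conv, pow_succ]

/-- The coefficients of `(∑ₙ cₙ Xⁿ) ^ p`, with the `p` compositions having a part equal to the
whole degree singled out. -/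
theorem coeff_mk_pow_eq_add_sum {R : Type*} [CommSemiring R] (c : ℕ → R) (hc : c 0 = 1) (p : ℕ)
    {n : ℕ} (hn : n ≠ 0) :
    (PowerSeries.mk c ^ p).coeff n = p * c n +
      ∑ i ∈ (Fintype.piFinset fun _ : Fin p => Finset.Ico 1 (n + 1)).filter
        (fun i => ∑ k, i k = n + p), ∏ k, c (i k - 1) := by
  have h1 : PowerSeries.mk c ^ p = ∏ _k : Fin p, PowerSeries.mk c := by simp
  rw [h1, PowerSeries.coeff_prod,
    ← Finset.sum_filter_not_add_sum_filter (Finset.finsuppAntidiag Finset.univ n)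
      (fun l => ∀ k, l k < n)]
  simp only [PowerSeries.coeff_mk]
  congr 1
  · have h2 : (Finset.finsuppAntidiag Finset.univ n).filter
        (fun l : Fin p →₀ ℕ => ¬ ∀ k, l k < n) =
        Finset.univ.image fun k : Fin p => Finsupp.single k n := by
      ext l
      simp only [Finset.mem_filter, Finset.mem_finsuppAntidiag, Finset.mem_image,
        Finset.mem_univ, true_and, Finset.subset_univ, and_true, not_forall, not_lt]
      constructor
      · rintro ⟨hl, k, hk⟩
        refine ⟨k, ?_⟩
        rw [← Finset.add_sum_erase _ _ (Finset.mem_univ k)] at hl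
        have h0 : ∑ j ∈ Finset.univ.erase k, l j = 0 := by omega
        ext j
        by_cases hj : j = k
        · subst hj
          simp
          omega
        · rw [Finsupp.single_eq_of_ne hj]
          exact (Finset.sum_eq_zero_iff.1 h0 j (by simp [hj])).symm
      · rintro ⟨k, rfl⟩
        refine ⟨?_, k, by simp⟩
        simp [Finsupp.single_apply]
    rw [h2, Finset.sum_image fun a _ b _ h => Finsupp.single_left_injective hn h]
    have h3 (k : Fin p) : ∏ j, c (Finsupp.single k n j) = c n := by
      rw [Finset.prod_eq_single k]
      · simp
      · intro j _ hj
        rw [Finsupp.single_eq_of_ne hj, hc]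
      · simp
    simp [h3]
  · refine Finset.sum_bij' (fun l _ => fun k => l k + 1)
      (fun i _ => Finsupp.equivFunOnFinite.symm fun k => i k - 1) ?_ ?_ ?_ ?_ ?_
    · intro l hl
      simp only [Finset.mem_filter, Finset.mem_finsuppAntidiag] at hl
      simp [Finset.sum_add_distrib, hl.1.1, hl.2]
    · intro i hi
      simp only [Finset.mem_filter, Fintype.mem_piFinset, Finset.mem_Ico] at hi
      have h4 : ∑ k, (i k - 1) + p = n + p := by
        rw [← hi.2]
        calc ∑ k, (i k - 1) + p = ∑ k, ((i k - 1) + 1) := by simp [Finset.sum_add_distrib]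
          _ = _ := Finset.sum_congr rfl fun k _ => Nat.sub_add_cancel (hi.1 k).1
      simp only [Finset.mem_filter, Finset.mem_finsuppAntidiag, Finset.subset_univ, and_true,
        Finsupp.equivFunOnFinite_symm_apply_apply]
      exact ⟨by omega, fun k => by have := hi.1 k; omega⟩
    · intro l hl
      ext k
      simp
    · intro i hi
      simp only [Finset.mem_filter, Fintype.mem_piFinset, Finset.mem_Ico] at hi
      ext k
      have := hi.1 k
      simp
      omega
    · intro l hl
      simp

open PowerSeries in
theorem coeff_succ_mul_of_pow_eq_mk_one {φ : PowerSeries ℝ} {p : ℕ} (hp : p ≠ 0)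
    (hφ : φ ^ p = PowerSeries.mk 1) (n : ℕ) :
    p * (n + 1) * φ.coeff (n + 1) = (p * n + 1) * φ.coeff n := by
  have h1 : (PowerSeries.mk 1 : PowerSeries ℝ) * (1 - X) = 1 := mk_one_mul_one_sub_eq_one ℝ
  have hφ0 : φ ≠ 0 := by
    rintro rfl
    rw [zero_pow hp] at hφ
    rw [← hφ, zero_mul] at h1
    exact zero_ne_one h1
  have h2 : d⁄dX ℝ (φ ^ p) * (1 - X) = φ ^ p := by
    have h3 := congrArg (d⁄dX ℝ) h1
    rw [Derivation.leibniz, map_sub, derivative_X, derivative_one, ← hφ] at h3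
    simp only [smul_eq_mul] at h3
    linear_combination h3
  rw [derivative_pow] at h2
  have h3 : (p : PowerSeries ℝ) * (d⁄dX ℝ φ) * (1 - X) = φ := by
    refine mul_left_cancel₀ (pow_ne_zero (p - 1) hφ0) ?_
    rw [pow_sub_one_mul hp]
    linear_combination h2
  have h4 := congrArg (coeff n) h3
  rw [← map_natCast (C (R := ℝ)), mul_assoc, coeff_C_mul, mul_sub, mul_one, map_sub] at h4
  cases n with
  | zero =>
    simp [coeff_derivative] at h4 ⊢
    linarith
  | succ n =>
    rw [coeff_succ_mul_X, coeff_derivative, coeff_derivative] at h4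
    push_cast at h4 ⊢
    linarith

theorem coeff_mem_Icc_of_pow_eq_mk_one {φ : PowerSeries ℝ} {p : ℕ} (hp : p ≠ 0)
    (hφ : φ ^ p = PowerSeries.mk 1) (h0 : φ.coeff 0 = 1) (n : ℕ) :
    φ.coeff n ∈ Set.Icc (0 : ℝ) 1 := by
  have hp' : (1 : ℝ) ≤ p := by exact_mod_cast Nat.one_le_iff_ne_zero.2 hp
  induction n with
  | zero => simp [h0]
  | succ n ih =>
    have h := coeff_succ_mul_of_pow_eq_mk_one hp hφ n
    have hpos : (0 : ℝ) < p * (n + 1) := by positivity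
    obtain ⟨ih0, ih1⟩ := ih
    constructor
    · refine nonneg_of_mul_nonneg_right (?_ : (0 : ℝ) ≤ p * (n + 1) * _) hpos
      rw [h]
      positivity
    · refine le_of_mul_le_mul_left ?_ hpos
      rw [h]
      nlinarith [mul_le_mul_of_nonneg_left ih1 (by positivity : (0 : ℝ) ≤ p * n + 1)]

/-- Let `ν_t` be the signed measure given by the Wild sum for the
`m`-agent model, `ν_t = Σ_{n≥1} b(n) e^{−λt}(1−e^{−(m−1)λt})^{n−1} μ₀^{*[(m−1)(n−1)+1]}`.
Then its `(m−1)`-fold convolution power is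
`Σ_{n≥1} e^{−(m−1)λt}(1−e^{−(m−1)λt})^{n−1} μ₀^{*(m−1)n}` (equality tested on every
Borel set). -/
theorem wildSum_conv_power_eq (m : ℕ) (hm : 2 ≤ m) (lam : ℝ) (hlam : 0 < lam)
    (μ₀ : Measure ℝ) [IsProbabilityMeasure μ₀] (b : ℕ → ℝ)
    (hb1 : b 1 = 1)
    (hbrec : ∀ n > 1, b n =
      ((m : ℝ) - 1)⁻¹ *
        (1 - ∑ i ∈ (Fintype.piFinset fun _ : Fin (m - 1) => Finset.Ico 1 n).filter
              (fun i => ∑ k, i k = n + m - 2),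
            ∏ k, b (i k)))
    (t : ℝ) (ht : 0 ≤ t) (ν : SignedMeasure ℝ)
    (hν : ∀ A : Set ℝ, MeasurableSet A →
      ν A = ∑' n : ℕ,
        b (n + 1) * Real.exp (-(lam * t)) *
            (1 - Real.exp (-((m - 1 : ℕ) * lam * t))) ^ n *
          ((convPow μ₀ ((m - 1) * n + 1)) A).toReal) :
    ∀ A : Set ℝ, MeasurableSet A →
      (sconvPow ν (m - 1)) A = ∑' n : ℕ,
        Real.exp (-((m - 1 : ℕ) * lam * t)) *
            (1 - Real.exp (-((m - 1 : ℕ) * lam * t))) ^ n *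
          ((convPow μ₀ ((m - 1) * (n + 1))) A).toReal := by
  obtain ⟨p, rfl⟩ : ∃ p, m = p + 1 := ⟨m - 1, by omega⟩
  have hp : p ≠ 0 := by omega
  have hp' : (p : ℝ) ≠ 0 := Nat.cast_ne_zero.2 hp
  simp only [Nat.add_sub_cancel] at hbrec hν ⊢
  set q : ℝ := 1 - Real.exp (-(p * lam * t)) with hq
  have hq0 : 0 ≤ q := by
    rw [hq, sub_nonneg, Real.exp_le_one_iff, neg_nonpos]
    positivity
  have hq1 : q < 1 := by
    rw [hq]
    linarith [Real.exp_pos (-(p * lam * t))]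
  have hpow : (PowerSeries.mk fun n => b (n + 1)) ^ p = PowerSeries.mk (1 : ℕ → ℝ) := by
    ext n
    rcases eq_or_ne n 0 with rfl | hn
    · simp [hb1]
    · rw [coeff_mk_pow_eq_add_sum _ hb1 p hn, hbrec (n + 1) (by omega)]
      have hsum : n + 1 + (p + 1) - 2 = n + p := by omega
      rw [hsum, Nat.cast_succ, add_sub_cancel_right, mul_inv_cancel_left₀ hp']
      have hcongr : ∑ i ∈ (Fintype.piFinset fun _ : Fin p => Finset.Ico 1 (n + 1)).filter
          (fun i => ∑ k, i k = n + p), ∏ k, b (i k - 1 + 1) =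
          ∑ i ∈ (Fintype.piFinset fun _ : Fin p => Finset.Ico 1 (n + 1)).filter
          (fun i => ∑ k, i k = n + p), ∏ k, b (i k) := by
        refine Finset.sum_congr rfl fun i hi => Finset.prod_congr rfl fun k _ => ?_
        simp only [Finset.mem_filter, Fintype.mem_piFinset, Finset.mem_Ico] at hi
        rw [Nat.sub_add_cancel (hi.1 k).1]
      rw [hcongr]
      simp
  have hb (n : ℕ) : b (n + 1) ∈ Set.Icc (0 : ℝ) 1 := by
    simpa using coeff_mem_Icc_of_pow_eq_mk_one hp hpow (by simp [hb1]) n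
  have hcoef (n : ℕ) : 0 ≤ b (n + 1) * Real.exp (-(lam * t)) * q ^ n :=
    mul_nonneg (mul_nonneg (hb n).1 (Real.exp_pos _).le) (pow_nonneg hq0 n)
  let f : PowerSeries ℝ≥0 :=
    PowerSeries.mk fun n => ⟨b (n + 1) * Real.exp (-(lam * t)) * q ^ n, hcoef n⟩
  have hf (n : ℕ) : (f.coeff n : ℝ) = b (n + 1) * Real.exp (-(lam * t)) * q ^ n := by
    exact congrArg NNReal.toReal (PowerSeries.coeff_mk n _)
  have hfs : Summable fun n => f.coeff n := by
    rw [← NNReal.summable_coe]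
    simp only [hf]
    refine Summable.of_nonneg_of_le hcoef (fun n => ?_)
      ((summable_geometric_of_lt_one hq0 hq1).mul_left (Real.exp (-(lam * t))))
    rw [mul_assoc]
    exact mul_le_of_le_one_left (by positivity) (hb n).2
  have hfpow (n : ℕ) :
      ((f ^ p).coeff n : ℝ) = Real.exp (-(p * lam * t)) * q ^ n := by
    have hmap : PowerSeries.map NNReal.toRealHom f = PowerSeries.C (Real.exp (-(lam * t))) *
        PowerSeries.rescale q (PowerSeries.mk fun n => b (n + 1)) := by
      ext n
      simp only [PowerSeries.coeff_map, NNReal.coe_toRealHom, hf, PowerSeries.coeff_C_mul,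
        PowerSeries.coeff_rescale, PowerSeries.coeff_mk]
      ring
    have := PowerSeries.coeff_map NNReal.toRealHom n (f ^ p)
    rw [map_pow, hmap, mul_pow, ← map_pow, ← map_pow, hpow, PowerSeries.coeff_C_mul,
      PowerSeries.coeff_rescale, PowerSeries.coeff_mk, ← Real.exp_nat_mul] at this
    rw [← NNReal.coe_toRealHom, ← this]
    simp [mul_assoc]
  have := isFiniteMeasure_convSeries μ₀ p f 1 hfs
  have hν' : ν = (convSeries μ₀ p f 1).toSignedMeasure := by
    ext A hA
    rw [hν A hA, Measure.toSignedMeasure_apply_measurable hA, convSeries_real_apply _ _ _ _ hA]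
    simp only [hf]
  intro A hA
  rw [hν', sconvPow_toSignedMeasure, Measure.toSignedMeasure_apply_measurable hA,
    convPow_convSeries, convSeries_real_apply _ _ _ _ hA]
  simp only [hfpow, mul_add, mul_one]
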